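/- Let E and F be real Hilbert spaces and let G : E × F → ℝ be twice continuously differentiable with 0 < α ≤ L₂ such that for all (R,H): (i) ⟨∇²_H G(R,H) v, v⟩ ≥ α‖v‖² for all v ∈ F and ‖∇²_H G(R,H)‖ ≤ L₂; (ii) ‖∇_R∇_H G(R,H)‖ ≤ L₂; (iii) for each fixed R, the map H ↦ ∇_R∇_H G(R,H) is L₃-Lipschitz; (iv) for each fixed R, the map H ↦ ∇²_H G(R,H) is L₄-Lipschitz. Let 0 < η ≤ 2/(L₂ + α). Let H_prev, H_next, H* : E → F be differentiable maps satisfying H_next(R) = H_prev(R) − η∇_H G(R, H_prev(R)) and ∇_H G(R, H*(R)) = 0 for all R ∈ E. Then for every R ∈ E: ‖DH_next(R) − DH*(R)‖ ≤ (1 − ηα)‖DH_prev(R) − DH*(R)‖ + η(L₂L₄/α + L₃)‖H_prev(R) − H*(R)‖. -/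

import Mathlib

open scoped RealInnerProductSpace

variable {E F : Type*} [NormedAddCommGroup E] [InnerProductSpace ℝ E] [CompleteSpace E]
  [NormedAddCommGroup F] [InnerProductSpace ℝ F] [CompleteSpace F]

/-- Partial gradient of `G : E → F → ℝ` in the second variable, `∇_H G(R, H)`. -/
noncomputable def gradH (G : E → F → ℝ) (R : E) (H : F) : F :=
  gradient (fun H' => G R H') H

/-- Hessian of `G : E → F → ℝ` in the second variable, `∇²_H G(R, H) : F →L[ℝ] F`. -/
noncomputable def hessH (G : E → F → ℝ) (R : E) (H : F) : F →L[ℝ] F :=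
  fderiv ℝ (fun H' => gradH G R H') H

/-- Mixed second derivative `∇_R ∇_H G(R, H) : E →L[ℝ] F`. -/
noncomputable def mixedRH (G : E → F → ℝ) (R : E) (H : F) : E →L[ℝ] F :=
  fderiv ℝ (fun R' => gradH G R' H) R

/-- The real-linear Riesz isometry from the dual of a real Hilbert space to the space. -/
noncomputable def rieszCLM (V : Type*) [NormedAddCommGroup V] [InnerProductSpace ℝ V]
    [CompleteSpace V] : (V →L[ℝ] ℝ) →L[ℝ] V :=
  (InnerProductSpace.toDual ℝ V).symm.toLinearIsometry.toContinuousLinearMap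

theorem inner_rieszCLM {V : Type*} [NormedAddCommGroup V] [InnerProductSpace ℝ V]
    [CompleteSpace V] (l : V →L[ℝ] ℝ) (v : V) : ⟪rieszCLM V l, v⟫ = l v :=
  InnerProductSpace.toDual_symm_apply

theorem norm_id_sub_smul_le {V : Type*} [NormedAddCommGroup V] [InnerProductSpace ℝ V]
    {A : V →L[ℝ] V} {α L η : ℝ} (hsymm : ∀ v w, ⟪A v, w⟫ = ⟪v, A w⟫)
    (hpos : ∀ v, α * ‖v‖ ^ 2 ≤ ⟪A v, v⟫) (hbound : ‖A‖ ≤ L) (hα : 0 < α) (hαL : α ≤ L)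
    (hη : 0 < η) (hη' : η ≤ 2 / (L + α)) :
    ‖ContinuousLinearMap.id ℝ V - η • A‖ ≤ 1 - η * α := by
  have hstep : η * (L + α) ≤ 2 := (le_div_iff₀ (by linarith)).mp hη'
  have hnonneg : 0 ≤ 1 - η * α := by nlinarith
  have hB : (ContinuousLinearMap.id ℝ V - η • A).IsSymmetric := by
    intro v w
    simp [inner_sub_left, inner_sub_right, inner_smul_left, inner_smul_right, hsymm]
  rw [ContinuousLinearMap.norm_eq_iSup_rayleighQuotient _ hB]
  refine Real.iSup_le (fun v ↦ ?_) hnonneg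
  have hupper : ⟪A v, v⟫ ≤ L * ‖v‖ ^ 2 := by
    calc ⟪A v, v⟫ ≤ ‖A v‖ * ‖v‖ := real_inner_le_norm _ _
      _ ≤ L * ‖v‖ * ‖v‖ := by gcongr; exact A.le_of_opNorm_le hbound v
      _ = L * ‖v‖ ^ 2 := by ring
  have hsq := sq_nonneg ‖v‖
  rw [ContinuousLinearMap.rayleighQuotient, abs_div, abs_sq]
  refine div_le_of_le_mul₀ hsq hnonneg ?_
  have hinner : (ContinuousLinearMap.id ℝ V - η • A).reApplyInnerSelf v
      = ‖v‖ ^ 2 - η * ⟪A v, v⟫ := by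
    simp [ContinuousLinearMap.reApplyInnerSelf_apply, inner_sub_left, inner_smul_left]
  rw [hinner, abs_le]
  have hlow := mul_le_mul_of_nonneg_left (hpos v) hη.le
  have hupp := mul_le_mul_of_nonneg_left hupper hη.le
  constructor <;> nlinarith [mul_le_mul_of_nonneg_right hstep hsq]

theorem norm_le_div_of_coercive_of_comp {U V : Type*} [NormedAddCommGroup U] [NormedSpace ℝ U]
    [NormedAddCommGroup V] [InnerProductSpace ℝ V] {A : V →L[ℝ] V} {D M : U →L[ℝ] V} {α L : ℝ}
    (hα : 0 < α) (hpos : ∀ v, α * ‖v‖ ^ 2 ≤ ⟪A v, v⟫) (hM : ‖M‖ ≤ L) (h : M + A.comp D = 0) :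
    ‖D‖ ≤ L / α := by
  have hL : 0 ≤ L := (norm_nonneg M).trans hM
  refine D.opNorm_le_bound (by positivity) fun u ↦ ?_
  have hAD : A (D u) = -M u := by
    have := DFunLike.congr_fun h u
    exact eq_neg_of_add_eq_zero_right (by simpa using this)
  have hkey : α * ‖D u‖ * ‖D u‖ ≤ L * ‖u‖ * ‖D u‖ := by
    calc α * ‖D u‖ * ‖D u‖ = α * ‖D u‖ ^ 2 := by ring
      _ ≤ ⟪A (D u), D u⟫ := hpos _
      _ ≤ ‖A (D u)‖ * ‖D u‖ := real_inner_le_norm _ _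
      _ ≤ L * ‖u‖ * ‖D u‖ := by
        rw [hAD, norm_neg]
        gcongr
        exact M.le_of_opNorm_le hM u
  rw [div_mul_eq_mul_div, le_div_iff₀ hα, mul_comm]
  rcases (norm_nonneg (D u)).eq_or_lt with h0 | h0
  · rw [← h0, mul_zero]
    positivity
  · exact le_of_mul_le_mul_right hkey h0

theorem contDiff_gradH {U V : Type*} [NormedAddCommGroup U] [InnerProductSpace ℝ U]
    [NormedAddCommGroup V] [InnerProductSpace ℝ V] [CompleteSpace V]
    {G : U → V → ℝ} (hG : ContDiff ℝ 2 (fun p : U × V ↦ G p.1 p.2)) :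
    ContDiff ℝ 1 (fun p : U × V ↦ gradH G p.1 p.2) := by
  have h : (fun p : U × V ↦ gradH G p.1 p.2) = fun p ↦ rieszCLM V
      ((fderiv ℝ (fun p : U × V ↦ G p.1 p.2) p).comp (ContinuousLinearMap.inr ℝ U V)) := by
    funext p
    have hd := (hG.differentiable (by norm_num) p).hasFDerivAt.comp (f := fun H ↦ (p.1, H)) p.2
      (hasFDerivAt_prodMk_right p.1 p.2)
    exact congrArg (rieszCLM V) hd.fderiv
  rw [h]
  exact (rieszCLM V).contDiff.comp
    ((hG.fderiv_right (m := 1) (by norm_num)).clm_comp contDiff_const)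

theorem inner_hessH_comm {U V : Type*} [NormedAddCommGroup U] [InnerProductSpace ℝ U]
    [NormedAddCommGroup V] [InnerProductSpace ℝ V] [CompleteSpace V]
    {G : U → V → ℝ} (hG : ContDiff ℝ 2 (fun p : U × V ↦ G p.1 p.2))
    (R : U) (H v w : V) : ⟪hessH G R H v, w⟫ = ⟪v, hessH G R H w⟫ := by
  have hGR : ContDiff ℝ 2 (G R) := hG.comp (contDiff_const.prodMk contDiff_id)
  have hd : DifferentiableAt ℝ (fderiv ℝ (G R)) H :=
    (hGR.fderiv_right (m := 1) (by norm_num)).differentiable (by norm_num) H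
  have hhess : hessH G R H = (rieszCLM V).comp (fderiv ℝ (fderiv ℝ (G R)) H) :=
    ((rieszCLM V).hasFDerivAt.comp H hd.hasFDerivAt).fderiv
  rw [real_inner_comm (hessH G R H w) v, hhess, ContinuousLinearMap.comp_apply,
    ContinuousLinearMap.comp_apply, inner_rieszCLM, inner_rieszCLM]
  exact hGR.contDiffAt.isSymmSndFDerivAt (by simp) v w

theorem hasFDerivAt_gradH_comp {U V : Type*} [NormedAddCommGroup U] [InnerProductSpace ℝ U]
    [NormedAddCommGroup V] [InnerProductSpace ℝ V] [CompleteSpace V]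
    {G : U → V → ℝ}
    (hG : ContDiff ℝ 2 (fun p : U × V ↦ G p.1 p.2)) {K : U → V} {R : U}
    (hK : DifferentiableAt ℝ K R) :
    HasFDerivAt (fun R' ↦ gradH G R' (K R'))
      (mixedRH G R (K R) + (hessH G R (K R)).comp (fderiv ℝ K R)) R := by
  have hd := ((contDiff_gradH hG).differentiable (by norm_num) (R, K R)).hasFDerivAt
  have hleft := hd.comp (f := fun R' ↦ (R', K R)) R (hasFDerivAt_prodMk_left R (K R))
  have hright := hd.comp (f := fun H ↦ (R, H)) (K R) (hasFDerivAt_prodMk_right R (K R))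
  have hmixed : mixedRH G R (K R) = _ := hleft.fderiv
  have hhess : hessH G R (K R) = _ := hright.fderiv
  convert! hd.comp R ((hasFDerivAt_id R).prodMk hK.hasFDerivAt) using 1
  ext u
  simp [hmixed, hhess, ← map_add]

/-- inequality (11) in the proof of Proposition 1. Jacobian-error recursion
for differentiating the gradient-descent update through the iterates:
`‖DH_next(R) − DH*(R)‖ ≤ (1 − ηα)‖DH_prev(R) − DH*(R)‖ + η(L₂L₄/α + L₃)‖H_prev(R) − H*(R)‖`. -/
theorem stmt6 (α L₂ L₃ L₄ η : ℝ) (hα : 0 < α) (hαL : α ≤ L₂)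
    (hη : 0 < η) (hη' : η ≤ 2 / (L₂ + α))
    (G : E → F → ℝ)
    (hGsmooth : ContDiff ℝ 2 (fun p : E × F => G p.1 p.2))
    (hhess_pos : ∀ (R : E) (H : F) (v : F), α * ‖v‖ ^ 2 ≤ ⟪hessH G R H v, v⟫)
    (hhess_bound : ∀ (R : E) (H : F), ‖hessH G R H‖ ≤ L₂)
    (hmixed_bound : ∀ (R : E) (H : F), ‖mixedRH G R H‖ ≤ L₂)
    (hmixed_lip : ∀ (R : E) (H H' : F),
      ‖mixedRH G R H - mixedRH G R H'‖ ≤ L₃ * ‖H - H'‖)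
    (hhess_lip : ∀ (R : E) (H H' : F),
      ‖hessH G R H - hessH G R H'‖ ≤ L₄ * ‖H - H'‖)
    (Hprev Hnext Hstar : E → F)
    (hdprev : Differentiable ℝ Hprev) (hdnext : Differentiable ℝ Hnext)
    (hdstar : Differentiable ℝ Hstar)
    (hupd : ∀ R : E, Hnext R = Hprev R - η • gradH G R (Hprev R))
    (hstat : ∀ R : E, gradH G R (Hstar R) = 0) :
    ∀ R : E,
      ‖fderiv ℝ Hnext R - fderiv ℝ Hstar R‖
        ≤ (1 - η * α) * ‖fderiv ℝ Hprev R - fderiv ℝ Hstar R‖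
          + η * (L₂ * L₄ / α + L₃) * ‖Hprev R - Hstar R‖ := by
  intro R
  have hjac : fderiv ℝ Hnext R = fderiv ℝ Hprev R - η • (mixedRH G R (Hprev R)
      + (hessH G R (Hprev R)).comp (fderiv ℝ Hprev R)) := by
    rw [funext hupd]
    exact ((hdprev R).hasFDerivAt.sub
      ((hasFDerivAt_gradH_comp hGsmooth (hdprev R)).const_smul η)).fderiv
  have hstar : mixedRH G R (Hstar R) + (hessH G R (Hstar R)).comp (fderiv ℝ Hstar R) = 0 := by
    rw [← (hasFDerivAt_gradH_comp hGsmooth (hdstar R)).fderiv, funext hstat]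
    simp
  have hDstar : ‖fderiv ℝ Hstar R‖ ≤ L₂ / α :=
    norm_le_div_of_coercive_of_comp hα (hhess_pos R _) (hmixed_bound R _) hstar
  have hcontr := norm_id_sub_smul_le (inner_hessH_comm hGsmooth R (Hprev R))
    (hhess_pos R _) (hhess_bound R _) hα hαL hη hη'
  have hsplit : fderiv ℝ Hnext R - fderiv ℝ Hstar R
      = (ContinuousLinearMap.id ℝ F - η • hessH G R (Hprev R)).comp
          (fderiv ℝ Hprev R - fderiv ℝ Hstar R)
        - η • ((hessH G R (Hprev R) - hessH G R (Hstar R)).comp (fderiv ℝ Hstar R)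
          + (mixedRH G R (Hprev R) - mixedRH G R (Hstar R))) := by
    rw [hjac, eq_neg_of_add_eq_zero_left hstar]
    ext u
    simp only [sub_apply, add_apply,
      smul_apply, ContinuousLinearMap.comp_apply,
      neg_apply, ContinuousLinearMap.id_apply, map_sub]
    module
  rw [hsplit]
  calc _ ≤ ‖ContinuousLinearMap.id ℝ F - η • hessH G R (Hprev R)‖
          * ‖fderiv ℝ Hprev R - fderiv ℝ Hstar R‖
        + η * (‖hessH G R (Hprev R) - hessH G R (Hstar R)‖ * ‖fderiv ℝ Hstar R‖
          + ‖mixedRH G R (Hprev R) - mixedRH G R (Hstar R)‖) := by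
        refine (norm_sub_le _ _).trans (add_le_add (ContinuousLinearMap.opNorm_comp_le _ _) ?_)
        rw [norm_smul, Real.norm_of_nonneg hη.le]
        gcongr
        exact (norm_add_le _ _).trans
          (add_le_add (ContinuousLinearMap.opNorm_comp_le _ _) le_rfl)
    _ ≤ (1 - η * α) * ‖fderiv ℝ Hprev R - fderiv ℝ Hstar R‖
        + η * (L₄ * ‖Hprev R - Hstar R‖ * (L₂ / α) + L₃ * ‖Hprev R - Hstar R‖) := by
        have hlip := hhess_lip R (Hprev R) (Hstar R)
        have hlip_nonneg := (norm_nonneg _).trans hlip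
        gcongr
        exact hmixed_lip R _ _
    _ = _ := by ring
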